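/- Let Ω ⊆ ℝⁿ be open and let v^1,…,v^n : Ω → ℝ be twice continuously differentiable functions whose values are pairwise distinct at every point of Ω (v^i(u) ≠ v^j(u) for i ≠ j). For p ≠ q define Γ^p_{pq} := ∂_q v^p / (v^q − v^p). Then for all pairwise distinct indices i, j, k ∈ {1,…,n} and every point of Ω: ∂_i Γ^k_{kj} + Γ^k_{ki} Γ^k_{kj} − Γ^k_{kj} Γ^j_{ji} − Γ^k_{ki} Γ^i_{ij} = ((v^i − v^k)/(v^j − v^i)) · ( ∂_j Γ^k_{ki} − ∂_i Γ^k_{kj} ). -/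

import Mathlib

/-- Partial derivative of a scalar function on `ℝⁿ` in the `j`-th coordinate direction. -/
noncomputable def pd {n : ℕ} (f : (Fin n → ℝ) → ℝ) (j : Fin n) (p : Fin n → ℝ) : ℝ :=
  fderiv ℝ f p (Pi.single j 1)

theorem pd_comm {n : ℕ} {f : (Fin n → ℝ) → ℝ} {u : Fin n → ℝ}
    (hf : ContDiffAt ℝ 2 f u) (i j : Fin n) : pd (pd f i) j u = pd (pd f j) i u := by
  have hd : DifferentiableAt ℝ (fderiv ℝ f) u :=
    (hf.fderiv_right (m := 1) (by norm_num)).differentiableAt (by norm_num)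
  have key (a b : Fin n) :
      pd (pd f a) b u = fderiv ℝ (fderiv ℝ f) u (Pi.single b 1) (Pi.single a 1) := by
    change fderiv ℝ (fun p => fderiv ℝ f p (Pi.single a 1)) u (Pi.single b 1) = _
    rw [fderiv_clm_apply hd (differentiableAt_const _)]
    simp
  rw [key, key]
  exact (hf.isSymmSndFDerivAt (by simp)).eq _ _

theorem ContDiffAt.differentiableAt_pd {n : ℕ} {f : (Fin n → ℝ) → ℝ} {u : Fin n → ℝ}
    (hf : ContDiffAt ℝ 2 f u) (i : Fin n) : DifferentiableAt ℝ (pd f i) u :=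
  ((hf.fderiv_right (m := 1) (by norm_num)).differentiableAt (by norm_num)).clm_apply
    (differentiableAt_const _)

theorem pd_div {n : ℕ} {f g : (Fin n → ℝ) → ℝ} {u : Fin n → ℝ}
    (hf : DifferentiableAt ℝ f u) (hg : DifferentiableAt ℝ g u) (hu : g u ≠ 0) (i : Fin n) :
    pd (fun p => f p / g p) i u = (pd f i u * g u - f u * pd g i u) / g u ^ 2 := by
  have h := hf.hasFDerivAt.fun_mul ((hasDerivAt_inv hu).comp_hasFDerivAt u hg.hasFDerivAt)
  simp only [pd, div_eq_mul_inv]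
  rw [HasFDerivAt.fderiv (f := fun p => f p * (g p)⁻¹) h]
  simp only [Function.comp_apply, add_apply, smul_apply, smul_eq_mul]
  field_simp
  ring

theorem pd_sub {n : ℕ} {f g : (Fin n → ℝ) → ℝ} {u : Fin n → ℝ}
    (hf : DifferentiableAt ℝ f u) (hg : DifferentiableAt ℝ g u) (i : Fin n) :
    pd (fun p => f p - g p) i u = pd f i u - pd g i u := by
  unfold pd
  rw [fderiv_fun_sub hf hg]
  simp

/-- Tsarev's identity relating the two formulations of his integrability
condition, for `Γ^p_{pq} := ∂_q v^p / (v^q − v^p)`. -/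
theorem tsarev_identity
    (n : ℕ) (Ω : Set (Fin n → ℝ)) (hΩ : IsOpen Ω)
    (v : Fin n → (Fin n → ℝ) → ℝ)
    (hv : ∀ i, ContDiffOn ℝ 2 (v i) Ω)
    (hdist : ∀ u ∈ Ω, ∀ i j, i ≠ j → v i u ≠ v j u)
    (Γ : Fin n → Fin n → (Fin n → ℝ) → ℝ)
    (hΓ : ∀ p q, p ≠ q → ∀ u, Γ p q u = pd (v p) q u / (v q u - v p u)) :
    ∀ i j k, i ≠ j → j ≠ k → i ≠ k → ∀ u ∈ Ω,
      pd (Γ k j) i u + Γ k i u * Γ k j u - Γ k j u * Γ j i u - Γ k i u * Γ i j u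
        = ((v i u - v k u) / (v j u - v i u)) * (pd (Γ k i) j u - pd (Γ k j) i u) := by
  intro i j k hij hjk hik u hu
  have hc (l : Fin n) : ContDiffAt ℝ 2 (v l) u := (hv l).contDiffAt (hΩ.mem_nhds hu)
  have hd (l : Fin n) : DifferentiableAt ℝ (v l) u := (hc l).differentiableAt (by norm_num)
  have hne (p q : Fin n) (hpq : p ≠ q) : v q u - v p u ≠ 0 :=
    sub_ne_zero.mpr (hdist u hu q p hpq.symm)
  have hpd (p q r : Fin n) (hpq : p ≠ q) : pd (Γ p q) r u =
      (pd (pd (v p) q) r u * (v q u - v p u) - pd (v p) q u * (pd (v q) r u - pd (v p) r u)) /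
        (v q u - v p u) ^ 2 := by
    rw [funext (hΓ p q hpq), pd_div ((hc p).differentiableAt_pd q) ((hd q).fun_sub (hd p))
      (hne p q hpq), pd_sub (hd q) (hd p)]
  rw [hpd k j i hjk.symm, hpd k i j hik.symm, hΓ k i hik.symm, hΓ k j hjk.symm,
    hΓ j i hij.symm, hΓ i j hij, pd_comm (hc k) j i]
  have h₁ := hne k j hjk.symm
  have h₂ := hne k i hik.symm
  have h₃ := hne i j hij
  rw [← neg_sub (v j u) (v i u)]
  field_simp
  ring
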